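/- Let S = {(x,0) ∈ ℝ² : −1 < x < 0} ∪ {(x,1) ∈ ℝ² : 0 < x < 1}. Then S is orthogonally convex, but its closure cl(S) = {(x,0) : −1 ≤ x ≤ 0} ∪ {(x,1) : 0 ≤ x ≤ 1} is not orthogonally convex. -/

import Mathlib

/-- A set `S ⊆ ℝⁿ` is orthogonally convex if its intersection with every
axis-aligned line is connected (possibly empty, i.e. preconnected). -/
def OrthoConvex {n : ℕ} (S : Set (EuclideanSpace ℝ (Fin n))) : Prop :=
  ∀ (i : Fin n) (c : EuclideanSpace ℝ (Fin n)),
    IsPreconnected {p ∈ S | ∀ j, j ≠ i → p j = c j}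

/-- The set `S = {(x,0) : -1 < x < 0} ∪ {(x,1) : 0 < x < 1}` is orthogonally
convex, its closure is `{(x,0) : -1 ≤ x ≤ 0} ∪ {(x,1) : 0 ≤ x ≤ 1}`, and this
closure is not orthogonally convex. -/
theorem closure_not_orthoConvex
    (S : Set (EuclideanSpace ℝ (Fin 2)))
    (hS : S = {p : EuclideanSpace ℝ (Fin 2) | p 1 = 0 ∧ -1 < p 0 ∧ p 0 < 0} ∪
      {p : EuclideanSpace ℝ (Fin 2) | p 1 = 1 ∧ 0 < p 0 ∧ p 0 < 1}) :
    OrthoConvex S ∧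
      closure S = {p : EuclideanSpace ℝ (Fin 2) | p 1 = 0 ∧ -1 ≤ p 0 ∧ p 0 ≤ 0} ∪
        {p : EuclideanSpace ℝ (Fin 2) | p 1 = 1 ∧ 0 ≤ p 0 ∧ p 0 ≤ 1} ∧
      ¬ OrthoConvex (closure S) := by
  have hcl : closure S = {p : EuclideanSpace ℝ (Fin 2) | p 1 = 0 ∧ -1 ≤ p 0 ∧ p 0 ≤ 0} ∪
        {p : EuclideanSpace ℝ (Fin 2) | p 1 = 1 ∧ 0 ≤ p 0 ∧ p 0 ≤ 1} := by
    have c0 : Continuous fun p : EuclideanSpace ℝ (Fin 2) => p 0 := by fun_prop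
    have c1 : Continuous fun p : EuclideanSpace ℝ (Fin 2) => p 1 := by fun_prop
    have key : ∀ (u v b : ℝ), u < v →
        (∀ x ∈ Set.Ioo u v, (!₂[x, b] : EuclideanSpace ℝ (Fin 2)) ∈ S) →
        ∀ p : EuclideanSpace ℝ (Fin 2), p 1 = b → u ≤ p 0 → p 0 ≤ v → p ∈ closure S := by
      intro u v b huv h p h1 h2 h3
      have hc : Continuous fun x : ℝ => (!₂[x, b] : EuclideanSpace ℝ (Fin 2)) := by
        refine (PiLp.continuous_toLp 2 _).comp ?_
        refine continuous_pi fun i => ?_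
        fin_cases i
        · simpa using continuous_id'
        · simpa using continuous_const
      have hm : p 0 ∈ closure (Set.Ioo u v) := by
        rw [closure_Ioo huv.ne]; exact ⟨h2, h3⟩
      have := map_mem_closure hc hm h
      have e : (!₂[p 0, b] : EuclideanSpace ℝ (Fin 2)) = p := by
        ext i
        fin_cases i
        · simp
        · simp [h1]
      rwa [e] at this
    apply Set.Subset.antisymm
    · apply closure_minimal
      · rw [hS]
        rintro p (⟨h, h1, h2⟩ | ⟨h, h1, h2⟩)
        · exact Or.inl ⟨h, h1.le, h2.le⟩
        · exact Or.inr ⟨h, h1.le, h2.le⟩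
      · apply IsClosed.union
        · exact (isClosed_eq c1 continuous_const).inter
            ((isClosed_le continuous_const c0).inter (isClosed_le c0 continuous_const))
        · exact (isClosed_eq c1 continuous_const).inter
            ((isClosed_le continuous_const c0).inter (isClosed_le c0 continuous_const))
    · rintro p (⟨h, h1, h2⟩ | ⟨h, h1, h2⟩)
      · refine key (-1) 0 0 (by norm_num) ?_ p h h1 h2
        rintro x ⟨hx1, hx2⟩
        rw [hS]; left; simp [hx1, hx2]
      · refine key 0 1 1 (by norm_num) ?_ p h h1 h2
        rintro x ⟨hx1, hx2⟩
        rw [hS]; right; simp [hx1, hx2]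
  refine ⟨?_, hcl, ?_⟩
  · have conv1 : ∀ u v b : ℝ,
        Convex ℝ {p : EuclideanSpace ℝ (Fin 2) | p 1 = b ∧ u < p 0 ∧ p 0 < v} := by
      rintro u v b x ⟨hx, hx1, hx2⟩ y ⟨hy, hy1, hy2⟩ s t hs ht hst
      have := convex_Ioo u v (show x 0 ∈ Set.Ioo u v from ⟨hx1, hx2⟩)
        (show y 0 ∈ Set.Ioo u v from ⟨hy1, hy2⟩) hs ht hst
      refine ⟨?_, ?_, ?_⟩
      · simp [hx, hy, ← add_mul, hst]
      · simpa using this.1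
      · simpa using this.2
    have key : ∀ (i : Fin 2) (c x y : EuclideanSpace ℝ (Fin 2)), x ∈ S → y ∈ S →
        (∀ j, j ≠ i → x j = c j) → (∀ j, j ≠ i → y j = c j) →
        ∀ s t : ℝ, 0 ≤ s → 0 ≤ t → s + t = 1 → s • x + t • y ∈ S := by
      intro i c x y hx hy hxc hyc s t hs ht hst
      have hd : x 0 = y 0 ∨ x 1 = y 1 := by
        fin_cases i
        · right; rw [hxc 1 (by simp), hyc 1 (by simp)]
        · left; rw [hxc 0 (by simp), hyc 0 (by simp)]
      rw [hS] at hx hy ⊢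
      rcases hx with hx | hx <;> rcases hy with hy | hy
      · exact Or.inl (conv1 _ _ _ hx hy hs ht hst)
      · obtain ⟨a1, a2, a3⟩ := hx
        obtain ⟨b1, b2, b3⟩ := hy
        rcases hd with h | h <;> linarith
      · obtain ⟨a1, a2, a3⟩ := hx
        obtain ⟨b1, b2, b3⟩ := hy
        rcases hd with h | h <;> linarith
      · exact Or.inr (conv1 _ _ _ hx hy hs ht hst)
    intro i c
    apply Convex.isPreconnected
    rintro x ⟨hx, hxc⟩ y ⟨hy, hyc⟩ s t hs ht hst
    refine ⟨key i c x y hx hy hxc hyc s t hs ht hst, fun j hj => ?_⟩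
    simp [hxc j hj, hyc j hj, ← add_mul, hst]
  · intro h
    have h1 := h 1 0
    rw [hcl] at h1
    have h2 := (h1.image (fun p : EuclideanSpace ℝ (Fin 2) => p 1)
      (by fun_prop)).ordConnected
    have m2 := h2.out
      (⟨!₂[0, 0], ⟨Or.inl (by simp), by simp [Fin.forall_fin_two]⟩, rfl⟩)
      (⟨!₂[0, 1], ⟨Or.inr (by simp), by simp [Fin.forall_fin_two]⟩, rfl⟩)
      (show (1/2 : ℝ) ∈ Set.Icc (0 : ℝ) 1 by constructor <;> norm_num)
    obtain ⟨p, ⟨hp | hp, -⟩, e⟩ := m2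
    · have := hp.1
      simp only at e
      linarith
    · have := hp.1
      simp only at e
      linarith
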